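/- arXiv:2112.11936 — 3 statements merged into one kernel-verified Lean document; each statement's English description precedes it below -/
import Mathlib

section
/- Let L ≥ 1 and K ≥ 1 be integers and let ε > 0 and ζ > 0 be real constants. Let λ, μ ∈ ℝ^L have strictly positive entries in nonincreasing order, and suppose λ majorizes μ. Then Σ_{l=1}^L log₂(1 + 1/(K − 1 + ζ/(ε·λ_l))) ≤ Σ_{l=1}^L log₂(1 + 1/(K − 1 + ζ/(ε·μ_l))). (That is, the asymptotic sum-rate is Schur-concave in the eigenvalues of the receive correlation matrix at the user, so stronger spatial correlation at the user decreases the asymptotic sum-rate.) -/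
open Finset

/-- If the partial sums of `a` are nonnegative and the weights `w` are nondecreasing, then a weighted
sum of `a` is at most its sum times the last weight. -/
theorem sum_range_succ_mul_le_mul_sum (w a : ℕ → ℝ) (n : ℕ)
    (hw : ∀ i < n, w i ≤ w (i + 1)) (ha : ∀ k ≤ n, 0 ≤ ∑ i ∈ range k, a i) :
    ∑ i ∈ range (n + 1), w i * a i ≤ w n * ∑ i ∈ range (n + 1), a i := by
  induction n with
  | zero => simp
  | succ n ih =>
    have h := ih (fun i hi => hw i (by lia)) (fun k hk => ha k (by lia))
    have hmul := mul_le_mul_of_nonneg_right (hw n n.lt_succ_self) (ha (n + 1) le_rfl)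
    rw [sum_range_succ, sum_range_succ _ (n + 1), mul_add]
    linarith

/-- **Karamata's inequality** for a function `f` with a nonincreasing supergradient `d` on `s`. -/
theorem sum_le_sum_of_majorizes_of_supergradient {s : Set ℝ} {f d : ℝ → ℝ}
    (hd : AntitoneOn d s) (hf : ∀ x ∈ s, ∀ y ∈ s, f x - f y ≤ d y * (x - y))
    {L : ℕ} {x y : ℕ → ℝ} (hx : ∀ l < L, x l ∈ s) (hy : ∀ l < L, y l ∈ s)
    (hy_anti : ∀ i j, i ≤ j → j < L → y j ≤ y i)
    (hle : ∀ k < L, ∑ i ∈ range k, y i ≤ ∑ i ∈ range k, x i)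
    (heq : ∑ i ∈ range L, x i = ∑ i ∈ range L, y i) :
    ∑ l ∈ range L, f (x l) ≤ ∑ l ∈ range L, f (y l) := by
  cases L with
  | zero => simp
  | succ n =>
    have hweighted := sum_range_succ_mul_le_mul_sum (fun l => d (y l)) (fun l => x l - y l) n
      (fun i hi => hd (hy _ (by lia)) (hy _ (by lia)) (hy_anti _ _ (by lia) (by lia)))
      (fun k hk => by
        rw [sum_sub_distrib]
        exact sub_nonneg.2 (hle k (by lia)))
    rw [sum_sub_distrib, heq, sub_self, mul_zero] at hweighted
    rw [← sub_nonpos, ← sum_sub_distrib]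
    exact (sum_le_sum fun l hl => hf _ (hx l (mem_range.1 hl)) _ (hy l (mem_range.1 hl))).trans
      hweighted

theorem antitoneOn_div_affine_mul_affine {a c : ℝ} (ha : 0 ≤ a) (hc : 0 < c) :
    AntitoneOn (fun x => c / (((a + 1) * x + c) * (a * x + c))) (Set.Ioi 0) := by
  intro x (hx : 0 < x) y (hy : 0 < y) hxy
  dsimp only
  gcongr

theorem log_one_add_inv_add_div_sub_le {a c x y : ℝ} (ha : 0 ≤ a) (hc : 0 < c)
    (hx : 0 < x) (hy : 0 < y) :
    Real.log (1 + 1 / (a + c / x)) - Real.log (1 + 1 / (a + c / y)) ≤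
      c / (((a + 1) * y + c) * (a * y + c)) * (x - y) := by
  have hax : 0 < a * x + c := by positivity
  have hay : 0 < a * y + c := by positivity
  have hay' : 0 < (a + 1) * y + c := by positivity
  have hpos {t : ℝ} (ht : 0 < t) : 0 < 1 + 1 / (a + c / t) := by positivity
  have hrw {t : ℝ} (ht : 0 < t) :
      1 + 1 / (a + c / t) = ((a + 1) * t + c) / (a * t + c) := by
    have : a * t + c ≠ 0 := by positivity
    field_simp
    ring
  rw [← Real.log_div (hpos hx).ne' (hpos hy).ne']
  refine (Real.log_le_sub_one_of_pos (div_pos (hpos hx) (hpos hy))).trans ?_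
  rw [hrw hx, hrw hy, ← sub_nonneg]
  have hdiff : c / (((a + 1) * y + c) * (a * y + c)) * (x - y) -
      (((a + 1) * x + c) / (a * x + c) / (((a + 1) * y + c) / (a * y + c)) - 1) =
      a * c * (x - y) ^ 2 / (((a + 1) * y + c) * (a * y + c) * (a * x + c)) := by
    field_simp
    ring
  rw [hdiff]
  positivity

/-- Theorem 2 of the paper: the asymptotic sum-rate is Schur-concave in the
eigenvalues of the user receive correlation matrix, so if `λ` majorizes `μ` (both positive and
nonincreasing), the sum-rate under `λ` is at most the sum-rate under `μ`. -/
theorem sum_rate_schur_concave_in_user_correlation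
    (L K : ℕ) (hL : 1 ≤ L) (hK : 1 ≤ K) (ε ζ : ℝ) (hε : 0 < ε) (hζ : 0 < ζ)
    (lam mu : ℕ → ℝ)
    (hlam_pos : ∀ l < L, 0 < lam l) (hmu_pos : ∀ l < L, 0 < mu l)
    (hlam_anti : ∀ i j, i ≤ j → j < L → lam j ≤ lam i)
    (hmu_anti : ∀ i j, i ≤ j → j < L → mu j ≤ mu i)
    (hmaj_le : ∀ k < L, ∑ i ∈ range k, mu i ≤ ∑ i ∈ range k, lam i)
    (hmaj_eq : ∑ i ∈ range L, lam i = ∑ i ∈ range L, mu i) :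
    ∑ l ∈ range L, Real.logb 2 (1 + 1 / ((K : ℝ) - 1 + ζ / (ε * lam l))) ≤
      ∑ l ∈ range L, Real.logb 2 (1 + 1 / ((K : ℝ) - 1 + ζ / (ε * mu l))) := by
  have ha : (0 : ℝ) ≤ (K : ℝ) - 1 := sub_nonneg.2 (by exact_mod_cast hK)
  have hc : 0 < ζ / ε := div_pos hζ hε
  simp only [Real.logb, ← sum_div, ← div_div ζ ε]
  refine div_le_div_of_nonneg_right ?_ (Real.log_nonneg one_le_two)
  exact sum_le_sum_of_majorizes_of_supergradient
    (f := fun x => Real.log (1 + 1 / ((K : ℝ) - 1 + ζ / ε / x)))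
    (antitoneOn_div_affine_mul_affine ha hc)
    (fun x hx y hy => log_one_add_inv_add_div_sub_le ha hc hx hy)
    hlam_pos hmu_pos hmu_anti hmaj_le hmaj_eq
end

section
/- Let K ≥ 1, L ≥ 1 and M ≥ 1 be integers, let ε > 0, and for each k = 1, …, K and l = 1, …, L let a_{k,l} > 0 be real constants. Let λ, μ ∈ ℝ^M have nonnegative entries in nonincreasing order, suppose λ majorizes μ, and suppose Σ_{n=1}^M μ_n² > 0. Then Σ_{k=1}^K Σ_{l=1}^L log₂(1 + 1/(K − 1 + a_{k,l}/(ε·Σ_{n=1}^M λ_n²))) ≥ Σ_{k=1}^K Σ_{l=1}^L log₂(1 + 1/(K − 1 + a_{k,l}/(ε·Σ_{n=1}^M μ_n²))). (That is, when the RIS transmit- and receive-side correlation matrices are equal, T_I = R_I, so that Tr(T_I R_I) = Σ_n λ_n² with λ the eigenvalue vector of T_I, stronger spatial correlation at the RIS increases the asymptotic sum-rate.) -/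
open Finset

/-- If `f` is antitone and the partial sums of `d` are nonnegative, Abel summation bounds
`∑ f i * d i` below by the last value of `f` times the total sum of `d`. -/
theorem mul_sum_le_sum_mul_of_antitone {f d : ℕ → ℝ} (n : ℕ)
    (hf : ∀ i < n, f (i + 1) ≤ f i) (hd : ∀ k ≤ n, 0 ≤ ∑ i ∈ range k, d i) :
    f n * ∑ i ∈ range (n + 1), d i ≤ ∑ i ∈ range (n + 1), f i * d i := by
  induction n with
  | zero => simp
  | succ n ih =>
    have h := ih (fun i hi => hf i (hi.trans n.lt_succ_self))
      (fun k hk => hd k (hk.trans n.le_succ))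
    rw [sum_range_succ _ (n + 1), sum_range_succ _ (n + 1)]
    nlinarith [mul_le_mul_of_nonneg_right (hf n n.lt_succ_self) (hd (n + 1) le_rfl)]

/-- The sum of squares is monotone for the majorization order. -/
theorem sum_sq_le_sum_sq_of_majorizes {M : ℕ} {x y : ℕ → ℝ}
    (hy : ∀ i j, i ≤ j → j < M → y j ≤ y i)
    (hle : ∀ k < M, ∑ i ∈ range k, y i ≤ ∑ i ∈ range k, x i)
    (heq : ∑ i ∈ range M, x i = ∑ i ∈ range M, y i) :
    ∑ i ∈ range M, (y i) ^ 2 ≤ ∑ i ∈ range M, (x i) ^ 2 := by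
  cases M with
  | zero => simp
  | succ n =>
    have h := mul_sum_le_sum_mul_of_antitone (f := y) (d := fun i => x i - y i) n
      (fun i hi => hy i (i + 1) i.le_succ (by lia))
      (fun k hk => by
        rw [sum_sub_distrib]
        exact sub_nonneg.2 (hle k (by lia)))
    rw [sum_sub_distrib, heq, sub_self, mul_zero] at h
    have key : ∑ i ∈ range (n + 1), ((y i) ^ 2 + 2 * (y i * (x i - y i))) ≤
        ∑ i ∈ range (n + 1), (x i) ^ 2 :=
      sum_le_sum fun i _ => by nlinarith [sq_nonneg (x i - y i)]
    rw [sum_add_distrib, ← mul_sum] at key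
    linarith

/-- Theorem 3 of the paper: when the RIS transmit- and receive-side correlation
matrices are equal (so that `Tr(T_I R_I) = Σ_n λ_n²`), stronger spatial correlation at the RIS
(in the majorization order on the eigenvalue vector) increases the asymptotic sum-rate. -/
theorem sum_rate_schur_convex_in_ris_correlation
    (K L M : ℕ) (hK : 1 ≤ K) (hL : 1 ≤ L) (hM : 1 ≤ M)
    (ε : ℝ) (hε : 0 < ε)
    (a : ℕ → ℕ → ℝ) (ha : ∀ k < K, ∀ l < L, 0 < a k l)
    (lam mu : ℕ → ℝ)
    (hlam_nonneg : ∀ n < M, 0 ≤ lam n) (hmu_nonneg : ∀ n < M, 0 ≤ mu n)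
    (hlam_anti : ∀ i j, i ≤ j → j < M → lam j ≤ lam i)
    (hmu_anti : ∀ i j, i ≤ j → j < M → mu j ≤ mu i)
    (hmaj_le : ∀ k < M, ∑ i ∈ range k, mu i ≤ ∑ i ∈ range k, lam i)
    (hmaj_eq : ∑ i ∈ range M, lam i = ∑ i ∈ range M, mu i)
    (hmu_sq_pos : 0 < ∑ n ∈ range M, (mu n) ^ 2) :
    ∑ k ∈ range K, ∑ l ∈ range L,
        Real.logb 2 (1 + 1 / ((K : ℝ) - 1 + a k l / (ε * ∑ n ∈ range M, (mu n) ^ 2))) ≤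
      ∑ k ∈ range K, ∑ l ∈ range L,
        Real.logb 2 (1 + 1 / ((K : ℝ) - 1 + a k l / (ε * ∑ n ∈ range M, (lam n) ^ 2))) := by
  have hsq := sum_sq_le_sum_sq_of_majorizes hmu_anti hmaj_le hmaj_eq
  have hK' : (0 : ℝ) ≤ (K : ℝ) - 1 := sub_nonneg.2 (by exact_mod_cast hK)
  refine sum_le_sum fun k hk => sum_le_sum fun l hl => ?_
  have hakl := ha k (mem_range.1 hk) l (mem_range.1 hl)
  have hlam_sq_pos := hmu_sq_pos.trans_le hsq
  have hden : 0 < (K : ℝ) - 1 + a k l / (ε * ∑ n ∈ range M, (lam n) ^ 2) := by positivity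
  have hden' : 0 < (K : ℝ) - 1 + a k l / (ε * ∑ n ∈ range M, (mu n) ^ 2) := by positivity
  refine Real.logb_le_logb_of_le one_lt_two (by positivity) ?_
  gcongr
end

section
/- Let K ≥ 1 and L ≥ 1 be integers, let c_1, …, c_K ≥ 0 and σ_1², …, σ_K² > 0 be real constants, and let r_{k,l} ≥ 0 for k = 1, …, K, l = 1, …, L. Then the function F(x) = Σ_{k=1}^K Σ_{l=1}^L log₂(1 + c_k·r_{k,l} / (Σ_{i≠k} c_i·r_{k,l} + σ_k²/x)) is monotonically nondecreasing on (0, ∞). -/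
open Finset

/-- The rate `logb b (1 + s / (q + σ / x))` of a signal `s` against interference `q` and noise
`σ / x` is nondecreasing in `x` on `(0, ∞)`. -/
theorem monotoneOn_logb_one_add_div_add_div {b s q σ : ℝ} (hb : 1 < b) (hs : 0 ≤ s)
    (hq : 0 ≤ q) (hσ : 0 < σ) :
    MonotoneOn (fun x : ℝ => Real.logb b (1 + s / (q + σ / x))) (Set.Ioi 0) := by
  intro x (hx : 0 < x) y (hy : 0 < y) hxy
  have hle : s / (q + σ / x) ≤ s / (q + σ / y) := by gcongr
  exact Real.logb_le_logb_of_le hb (by positivity) (by linarith)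

/-- Section IV of the paper: the asymptotic sum-rate, viewed as a function of
the RIS trace term `x = φ_k·Tr(T_I Θ R_I Θᴴ)`, is monotonically nondecreasing on `(0, ∞)`.
This is what decouples the joint optimization of beamforming and phase shifts. -/
theorem sum_rate_monotone_in_ris_trace
    (K L : ℕ) (hK : 1 ≤ K) (hL : 1 ≤ L)
    (c : ℕ → ℝ) (hc : ∀ k < K, 0 ≤ c k)
    (σsq : ℕ → ℝ) (hσ : ∀ k < K, 0 < σsq k)
    (r : ℕ → ℕ → ℝ) (hr : ∀ k < K, ∀ l < L, 0 ≤ r k l) :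
    MonotoneOn
      (fun x : ℝ => ∑ k ∈ range K, ∑ l ∈ range L,
        Real.logb 2 (1 + c k * r k l /
          ((∑ i ∈ (range K).erase k, c i * r k l) + σsq k / x)))
      (Set.Ioi 0) := by
  intro x hx y hy hxy
  refine sum_le_sum fun k hk => sum_le_sum fun l hl => ?_
  have hk' := mem_range.mp hk
  have hrkl := hr k hk' l (mem_range.mp hl)
  have hq : 0 ≤ ∑ i ∈ (range K).erase k, c i * r k l :=
    sum_nonneg fun i hi => mul_nonneg (hc i (mem_range.mp (mem_of_mem_erase hi))) hrkl
  exact monotoneOn_logb_one_add_div_add_div one_lt_two (mul_nonneg (hc k hk') hrkl) hq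
    (hσ k hk') hx hy hxy
end
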